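/- arXiv:0707.2867 — 2 statements merged into one kernel-verified Lean document; each statement's English description precedes it below -/
import Mathlib

section
/- Let V be a real vector space of dimension 3 with a Lie bracket [·,·], let χ(x) = tr(ad x), and let λ(x,y) = [x,y] − (1/2)(χ(x)·y − χ(y)·x). Then for all real numbers s and t, the alternating bilinear map μ_{s,t}(x,y) = (s/2)(χ(x)·y − χ(y)·x) + t·λ(x,y) satisfies the Jacobi identity μ_{s,t}(μ_{s,t}(x,y),z) + μ_{s,t}(μ_{s,t}(y,z),x) + μ_{s,t}(μ_{s,t}(z,x),y) = 0. In particular (s = 0, t = 1), λ is itself a Lie bracket on V, so every 3-dimensional Lie bracket splits into two compatible Lie brackets. -/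
section

variable {V : Type*} [LieRing V] [LieAlgebra ℝ V]

/-- For a basis of a 3-dimensional Lie algebra, the cyclic sum of `tr(ad eᵢ) • ⁅eⱼ, eₖ⁆` coincides
with the Jacobiator, so it vanishes. -/
theorem trace_ad_smul_lie_basis_cyclic (b : Module.Basis (Fin 3) ℝ V) :
    LinearMap.trace ℝ V (LieAlgebra.ad ℝ V (b 0)) • ⁅b 1, b 2⁆
      + LinearMap.trace ℝ V (LieAlgebra.ad ℝ V (b 1)) • ⁅b 2, b 0⁆
      + LinearMap.trace ℝ V (LieAlgebra.ad ℝ V (b 2)) • ⁅b 0, b 1⁆ = 0 := by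
  have htr (i : Fin 3) : LinearMap.trace ℝ V (LieAlgebra.ad ℝ V (b i)) =
      b.repr ⁅b i, b 0⁆ 0 + b.repr ⁅b i, b 1⁆ 1 + b.repr ⁅b i, b 2⁆ 2 := by
    rw [LinearMap.trace_eq_matrix_trace ℝ b, Matrix.trace, Fin.sum_univ_three]
    simp [LinearMap.toMatrix_apply]
  have h01 : ⁅b 1, b 0⁆ = -⁅b 0, b 1⁆ := (lie_skew _ _).symm
  have h12 : ⁅b 2, b 1⁆ = -⁅b 1, b 2⁆ := (lie_skew _ _).symm
  have h20 : ⁅b 0, b 2⁆ = -⁅b 2, b 0⁆ := (lie_skew _ _).symm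
  have expand (v w : V) : ⁅w, v⁆ =
      b.repr v 0 • ⁅w, b 0⁆ + b.repr v 1 • ⁅w, b 1⁆ + b.repr v 2 • ⁅w, b 2⁆ := by
    conv_lhs => rw [← b.sum_repr v, Fin.sum_univ_three]
    simp only [lie_add, lie_smul]
  have jac := lie_jacobi (b 0) (b 1) (b 2)
  rw [expand ⁅b 1, b 2⁆, expand ⁅b 2, b 0⁆, expand ⁅b 0, b 1⁆] at jac
  simp only [h01, h12, h20, lie_self] at jac
  rw [htr 0, htr 1, htr 2]
  simp only [h01, h12, h20, lie_self, map_neg, map_zero, Finsupp.neg_apply, Finsupp.zero_apply]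
  linear_combination (norm := module) -jac

/-- In a 3-dimensional Lie algebra, the cyclic sum of `tr(ad x) • ⁅y, z⁆` vanishes. -/
theorem trace_ad_smul_lie_cyclic (hdim : Module.finrank ℝ V = 3) (x y z : V) :
    LinearMap.trace ℝ V (LieAlgebra.ad ℝ V x) • ⁅y, z⁆
      + LinearMap.trace ℝ V (LieAlgebra.ad ℝ V y) • ⁅z, x⁆
      + LinearMap.trace ℝ V (LieAlgebra.ad ℝ V z) • ⁅x, y⁆ = 0 := by
  have : FiniteDimensional ℝ V := .of_finrank_pos (by lia)
  let b : Module.Basis (Fin 3) ℝ V := Module.finBasisOfFinrankEq ℝ V hdim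
  have key := trace_ad_smul_lie_basis_cyclic b
  have h01 : ⁅b 1, b 0⁆ = -⁅b 0, b 1⁆ := (lie_skew _ _).symm
  have h12 : ⁅b 2, b 1⁆ = -⁅b 1, b 2⁆ := (lie_skew _ _).symm
  have h20 : ⁅b 0, b 2⁆ = -⁅b 2, b 0⁆ := (lie_skew _ _).symm
  rw [← b.sum_repr x, ← b.sum_repr y, ← b.sum_repr z]
  generalize b.repr x = p, b.repr y = q, b.repr z = r
  simp only [Fin.sum_univ_three, map_add, map_smul, lie_add, add_lie, lie_smul, smul_lie,
    h01, h12, h20, lie_self, smul_eq_mul]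
  linear_combination (norm := module)
    (p 0 * (q 1 * r 2 - q 2 * r 1) - p 1 * (q 0 * r 2 - q 2 * r 0)
      + p 2 * (q 0 * r 1 - q 1 * r 0)) • key

/-- A linear combination of a 3-dimensional Lie bracket and of the bracket
`tr(ad x) • y - tr(ad y) • x` satisfies the Jacobi identity. -/
theorem jacobi_of_lie_add_trace_ad (hdim : Module.finrank ℝ V = 3) (c d : ℝ) (m : V → V → V)
    (hm : ∀ x y, m x y = c • ⁅x, y⁆ + d • (LinearMap.trace ℝ V (LieAlgebra.ad ℝ V x) • y
      - LinearMap.trace ℝ V (LieAlgebra.ad ℝ V y) • x)) (x y z : V) :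
    m (m x y) z + m (m y z) x + m (m z x) y = 0 := by
  have key := trace_ad_smul_lie_cyclic hdim x y z
  have htr (u v : V) : LinearMap.trace ℝ V (LieAlgebra.ad ℝ V ⁅u, v⁆) = 0 := by simp
  have jac : ⁅⁅x, y⁆, z⁆ + ⁅⁅y, z⁆, x⁆ + ⁅⁅z, x⁆, y⁆ = 0 := by
    rw [← lie_skew ⁅x, y⁆ z, ← lie_skew ⁅y, z⁆ x, ← lie_skew ⁅z, x⁆ y]
    linear_combination (norm := module) -lie_jacobi x y z
  have hyx : ⁅y, x⁆ = -⁅x, y⁆ := (lie_skew _ _).symm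
  have hzy : ⁅z, y⁆ = -⁅y, z⁆ := (lie_skew _ _).symm
  have hxz : ⁅x, z⁆ = -⁅z, x⁆ := (lie_skew _ _).symm
  simp only [hm, map_add, map_sub, map_smul, htr, add_lie, sub_lie, smul_lie, hyx, hzy, hxz,
    smul_eq_mul]
  linear_combination (norm := module) (c * c) • jac + (c * d) • key

end


/-- On a 3-dimensional real Lie algebra with modular character
`χ(x) = tr(ad x)` and `λ(x,y) = ⁅x,y⁆ - (1/2)(χ(x)•y - χ(y)•x)`, for every `s, t ∈ ℝ`
the bracket `μ_{s,t}(x,y) = (s/2)(χ(x)•y - χ(y)•x) + t•λ(x,y)` satisfies the Jacobi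
identity; in particular (`s = 0, t = 1`) `λ` is itself a Lie bracket, so every
3-dimensional Lie bracket splits into two compatible Lie brackets. -/
theorem three_dim_lie_poisson_splits
    (V : Type*) [LieRing V] [LieAlgebra ℝ V] [FiniteDimensional ℝ V]
    (hdim : Module.finrank ℝ V = 3)
    (χ : V → ℝ) (hχ : ∀ x, χ x = LinearMap.trace ℝ V (LieAlgebra.ad ℝ V x))
    (lam : V → V → V)
    (hlam : ∀ x y, lam x y = ⁅x, y⁆ - (1 / 2 : ℝ) • (χ x • y - χ y • x))
    (s t : ℝ) (μ : V → V → V)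
    (hμ : ∀ x y, μ x y = (s / 2) • (χ x • y - χ y • x) + t • lam x y) :
    (∀ x y z, μ (μ x y) z + μ (μ y z) x + μ (μ z x) y = 0) ∧
    (∀ x y z, lam (lam x y) z + lam (lam y z) x + lam (lam z x) y = 0) := by
  refine ⟨jacobi_of_lie_add_trace_ad hdim t ((s - t) / 2) μ fun x y => ?_,
    jacobi_of_lie_add_trace_ad hdim 1 (-1 / 2) lam fun x y => ?_⟩
  · rw [hμ, hlam, hχ, hχ]
    module
  · rw [hlam, hχ, hχ]
    module
end

section
/- Let k ∈ ℝ³, let A be a symmetric 3×3 real matrix with Ak = 0, let K ∈ M₃(ℝ) with tr(K) = 0, and let F ∈ ℝ[x₁,x₂,x₃] be a homogeneous cubic polynomial with (KX)·∇F = 0. Then the bracket {·,·}_{k,A,K,F} satisfies the Jacobi identity ({{g,h},l} + {{h,l},g} + {{l,g},h} = 0 for all polynomials g,h,l) if and only if k·∇F = −(1/6)·Xᵀ(12A + k̃)K X as polynomials, where k̃ is the 3×3 skew-symmetric matrix with k̃w = k×w for all w ∈ ℝ³. -/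
open MvPolynomial Matrix

noncomputable section

/-- The Euler operator `E(g) = Σᵢ xᵢ ∂g/∂xᵢ`. -/
def euler (g : MvPolynomial (Fin 3) ℝ) : MvPolynomial (Fin 3) ℝ :=
  ∑ i : Fin 3, X i * pderiv i g

/-- `k·∇g` for a constant vector `k ∈ ℝ³`. -/
def dotGradConst (k : Fin 3 → ℝ) (g : MvPolynomial (Fin 3) ℝ) : MvPolynomial (Fin 3) ℝ :=
  ∑ i : Fin 3, C (k i) * pderiv i g

/-- `(KX)·∇g` for a matrix `K`. -/
def dotGradLin (K : Matrix (Fin 3) (Fin 3) ℝ) (g : MvPolynomial (Fin 3) ℝ) :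
    MvPolynomial (Fin 3) ℝ :=
  ∑ i : Fin 3, (∑ j : Fin 3, C (K i j) * X j) * pderiv i g

/-- The quadratic form `XᵀMX` as a polynomial. -/
def quadForm (M : Matrix (Fin 3) (Fin 3) ℝ) : MvPolynomial (Fin 3) ℝ :=
  ∑ i : Fin 3, ∑ j : Fin 3, C (M i j) * X i * X j

/-- `det[∇a, ∇b, ∇c]`: the determinant of the 3×3 matrix whose columns are the
gradients of `a`, `b`, `c`. -/
def gradDet (a b c : MvPolynomial (Fin 3) ℝ) : MvPolynomial (Fin 3) ℝ :=
  (Matrix.of fun i j => ![fun i' => pderiv i' a, fun i' => pderiv i' b,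
    fun i' => pderiv i' c] j i).det

/-- The bracket `{g,h}_{k,A,K,F}` of the bivector field `π_{k,f} + π_{K,F}`
(with `f = XᵀAX`): `det[∇(f+F), ∇g, ∇h] + (1/2)(E(g)(k·∇h) − (k·∇g)E(h))
+ (1/3)(E(g)((KX)·∇h) − ((KX)·∇g)E(h))`. -/
def pbracket (k : Fin 3 → ℝ) (A K : Matrix (Fin 3) (Fin 3) ℝ)
    (F : MvPolynomial (Fin 3) ℝ) (g h : MvPolynomial (Fin 3) ℝ) : MvPolynomial (Fin 3) ℝ :=
  gradDet (quadForm A + F) g h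
    + C (1 / 2 : ℝ) * (euler g * dotGradConst k h - dotGradConst k g * euler h)
    + C (1 / 3 : ℝ) * (euler g * dotGradLin K h - dotGradLin K g * euler h)

/-- The bracket `W · (∇g × ∇h)` of the bivector field dual to the vector field `W`. -/
def crossBracket (W : Fin 3 → MvPolynomial (Fin 3) ℝ) (g h : MvPolynomial (Fin 3) ℝ) :
    MvPolynomial (Fin 3) ℝ :=
  W 0 * (pderiv 1 g * pderiv 2 h - pderiv 2 g * pderiv 1 h)
    + W 1 * (pderiv 2 g * pderiv 0 h - pderiv 0 g * pderiv 2 h)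
    + W 2 * (pderiv 0 g * pderiv 1 h - pderiv 1 g * pderiv 0 h)

/-- The helicity density `W · curl W` of a vector field `W`. -/
def dotCurl (W : Fin 3 → MvPolynomial (Fin 3) ℝ) : MvPolynomial (Fin 3) ℝ :=
  W 0 * (pderiv 1 (W 2) - pderiv 2 (W 1)) + W 1 * (pderiv 2 (W 0) - pderiv 0 (W 2))
    + W 2 * (pderiv 0 (W 1) - pderiv 1 (W 0))

lemma pderiv_pderiv_comm (i j : Fin 3) (p : MvPolynomial (Fin 3) ℝ) :
    pderiv i (pderiv j p) = pderiv j (pderiv i p) := by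
  have h : ⁅pderiv (R := ℝ) i, pderiv (R := ℝ) j⁆ = 0 := by
    refine MvPolynomial.derivation_ext fun n => ?_
    simp [Derivation.commutator_apply, pderiv_X, Pi.single_apply, apply_ite]
  simpa [Derivation.commutator_apply, sub_eq_zero] using
    congrArg (fun D : Derivation ℝ (MvPolynomial (Fin 3) ℝ) _ => D p) h

lemma crossBracket_jacobiator (W : Fin 3 → MvPolynomial (Fin 3) ℝ)
    (g h l : MvPolynomial (Fin 3) ℝ) :
    crossBracket W (crossBracket W g h) l + crossBracket W (crossBracket W h l) g
      + crossBracket W (crossBracket W l g) h = dotCurl W * gradDet g h l := by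
  simp only [crossBracket, dotCurl, gradDet, det_fin_three, of_apply, cons_val, map_add, map_sub,
    Derivation.leibniz, smul_eq_mul, pderiv_pderiv_comm 1 0, pderiv_pderiv_comm 2 0,
    pderiv_pderiv_comm 2 1]
  ring

/-- The Jacobi identity for the bracket dual to `W` is the integrability condition
`W · curl W = 0`. -/
lemma crossBracket_jacobi_iff (W : Fin 3 → MvPolynomial (Fin 3) ℝ) :
    (∀ g h l, crossBracket W (crossBracket W g h) l + crossBracket W (crossBracket W h l) g
      + crossBracket W (crossBracket W l g) h = 0) ↔ dotCurl W = 0 := by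
  simp only [crossBracket_jacobiator]
  refine ⟨fun H => ?_, fun H g h l => by simp [H]⟩
  simpa [gradDet, det_fin_three, pderiv_X, Pi.single_apply] using H (X 0) (X 1) (X 2)

/-- The linear vector field `KX`. -/
def linField (K : Matrix (Fin 3) (Fin 3) ℝ) (i : Fin 3) : MvPolynomial (Fin 3) ℝ :=
  ∑ j : Fin 3, C (K i j) * X j

/-- The vector field `∇(f+F) + (1/2) X × k + (1/3) X × KX` dual to `π_{k,f} + π_{K,F}`. -/
def dualField (k : Fin 3 → ℝ) (A K : Matrix (Fin 3) (Fin 3) ℝ) (F : MvPolynomial (Fin 3) ℝ) :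
    Fin 3 → MvPolynomial (Fin 3) ℝ := fun i =>
  pderiv i (quadForm A + F)
    + C (1 / 2 : ℝ) * (X (i + 1) * C (k (i + 2)) - X (i + 2) * C (k (i + 1)))
    + C (1 / 3 : ℝ) * (X (i + 1) * linField K (i + 2) - X (i + 2) * linField K (i + 1))

lemma pbracket_eq_crossBracket (k : Fin 3 → ℝ) (A K : Matrix (Fin 3) (Fin 3) ℝ)
    (F g h : MvPolynomial (Fin 3) ℝ) :
    pbracket k A K F g h = crossBracket (dualField k A K F) g h := by
  simp only [pbracket, crossBracket, dualField, gradDet, det_fin_three, of_apply, cons_val, euler,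
    dotGradConst, dotGradLin, linField, Fin.sum_univ_three, Fin.isValue, Fin.reduceAdd]
  ring

lemma pderiv_linField (K : Matrix (Fin 3) (Fin 3) ℝ) (i j : Fin 3) :
    pderiv j (linField K i) = C (K i j) := by
  simp [linField, pderiv_X, Pi.single_apply]

lemma pderiv_quadForm {A : Matrix (Fin 3) (Fin 3) ℝ} (hA : A.IsSymm) (i : Fin 3) :
    pderiv i (quadForm A) = 2 * linField A i := by
  fin_cases i <;>
  simp [quadForm, linField, Fin.sum_univ_three, pderiv_X, hA.apply 0 1, hA.apply 0 2,
    hA.apply 1 2] <;>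
  ring

lemma curl_dualField (k : Fin 3 → ℝ) (A : Matrix (Fin 3) (Fin 3) ℝ)
    {K : Matrix (Fin 3) (Fin 3) ℝ} (hK : K.trace = 0) (F : MvPolynomial (Fin 3) ℝ) (i : Fin 3) :
    pderiv (i + 1) (dualField k A K F (i + 2)) - pderiv (i + 2) (dualField k A K F (i + 1))
      = -(C (k i) + linField K i) := by
  have hK' : (C (K 0 0) + C (K 1 1) + C (K 2 2) : MvPolynomial (Fin 3) ℝ) = 0 := by
    rw [← C_add, ← C_add, ← trace_fin_three, hK, C_0]
  have h2 : (C (2⁻¹ : ℝ) * 2 : MvPolynomial (Fin 3) ℝ) = 1 := by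
    rw [← map_ofNat C 2, ← C_mul]; norm_num
  have h3 : (C (3⁻¹ : ℝ) * 3 : MvPolynomial (Fin 3) ℝ) = 1 := by
    rw [← map_ofNat C 3, ← C_mul]; norm_num
  have hc := pderiv_pderiv_comm (i + 1) (i + 2) (quadForm A + F)
  fin_cases i <;>
  simp only [dualField, Fin.isValue, Fin.reduceAdd, Fin.zero_eta, Fin.mk_one, Fin.reduceFinMk,
    map_add, map_sub, Derivation.leibniz, smul_eq_mul, pderiv_C, pderiv_linField, pderiv_X,
    Pi.single_apply] at hc ⊢ <;>
  simp [linField, Fin.sum_univ_three] at hc ⊢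
  · linear_combination hc - C (k 0) * h2 + C 3⁻¹ * X 0 * hK'
      - (C (K 0 0) * X 0 + C (K 0 1) * X 1 + C (K 0 2) * X 2) * h3
  · linear_combination hc - C (k 1) * h2 + C 3⁻¹ * X 1 * hK'
      - (C (K 1 0) * X 0 + C (K 1 1) * X 1 + C (K 1 2) * X 2) * h3
  · linear_combination hc - C (k 2) * h2 + C 3⁻¹ * X 2 * hK'
      - (C (K 2 0) * X 0 + C (K 2 1) * X 1 + C (K 2 2) * X 2) * h3

lemma dotCurl_dualField (k : Fin 3 → ℝ) (A K : Matrix (Fin 3) (Fin 3) ℝ)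
    (hA : A.IsSymm) (hAk : A.mulVec k = 0) (hK : K.trace = 0)
    (F : MvPolynomial (Fin 3) ℝ) (hKF : dotGradLin K F = 0)
    (ktil : Matrix (Fin 3) (Fin 3) ℝ) (hktil : ∀ w, ktil.mulVec w = crossProduct k w) :
    dotCurl (dualField k A K F) = -(dotGradConst k F
      + C (1 / 6 : ℝ) * quadForm (((12 : ℝ) • A + ktil) * K)) := by
  have h0 := curl_dualField k A hK F 0
  have h1 := curl_dualField k A hK F 1
  have h2 := curl_dualField k A hK F 2
  simp only [Fin.isValue, Fin.reduceAdd] at h0 h1 h2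
  have hktil' : ktil = !![0, -k 2, k 1; k 2, 0, -k 0; -k 1, k 0, 0] := by
    ext i j
    have := congrFun (hktil (Pi.single j 1)) i
    fin_cases i <;> fin_cases j <;> simpa [crossProduct] using this
  have hAk' : ∀ i, (C (A i 0) * C (k 0) + C (A i 1) * C (k 1) + C (A i 2) * C (k 2) :
      MvPolynomial (Fin 3) ℝ) = 0 := fun i => by
    simpa [mulVec, dotProduct, Fin.sum_univ_three] using congrArg (C (σ := Fin 3)) (congrFun hAk i)
  have s2 : (C (1 / 2 : ℝ) : MvPolynomial (Fin 3) ℝ) = 3 * C (1 / 6) := by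
    rw [← map_ofNat C 3, ← C_mul]; norm_num
  have s3 : (C (1 / 3 : ℝ) : MvPolynomial (Fin 3) ℝ) = 2 * C (1 / 6) := by
    rw [← map_ofNat C 2, ← C_mul]; norm_num
  have s6 : (6 * C (1 / 6 : ℝ) : MvPolynomial (Fin 3) ℝ) = 1 := by
    rw [← map_ofNat C 6, ← C_mul]; norm_num
  have hAK : 2 * (∑ i, linField A i * linField K i) * (6 * C (1 / 6 : ℝ))
      = 2 * (∑ i, linField A i * linField K i) := by rw [s6, mul_one]
  simp only [linField, Fin.sum_univ_three, hA.apply 0 1, hA.apply 0 2, hA.apply 1 2] at hAK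
  rw [dotCurl, h0, h1, h2, hktil']
  simp only [dotGradLin, Fin.sum_univ_three] at hKF
  simp only [dualField, map_add, pderiv_quadForm hA]
  simp only [s2, s3, quadForm, dotGradConst, linField, map_add, Fin.sum_univ_three, Fin.isValue,
    Fin.reduceAdd, Matrix.mul_apply, Matrix.add_apply, Matrix.smul_apply, smul_eq_mul, of_apply,
    cons_val, map_mul, map_neg, map_zero, map_ofNat, hA.apply 0 1, hA.apply 0 2, hA.apply 1 2]
  have a0 := hAk' 0
  have a1 := hAk' 1
  have a2 := hAk' 2
  rw [hA.apply 0 1] at a1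
  rw [hA.apply 0 2, hA.apply 1 2] at a2
  linear_combination hAK - hKF - 2 * X 0 * a0 - 2 * X 1 * a1 - 2 * X 2 * a2

/-- For a compatible pair `(k, f = XᵀAX)` of a Lie-Poisson structure
(`A` symmetric, `Ak = 0`) and a compatible pair `(K,F)` of a quadratic Poisson structure
(`tr K = 0`, `F` homogeneous cubic, `(KX)·∇F = 0`), the deformed bracket
`{·,·}_{k,A,K,F}` satisfies the Jacobi identity if and only if
`k·∇F = −(1/6)·Xᵀ(12A + k̃)K X`, where `k̃` is the skew matrix with `k̃w = k×w`. -/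
theorem quadratic_deformation_criterion
    (k : Fin 3 → ℝ) (A : Matrix (Fin 3) (Fin 3) ℝ) (hA : A.IsSymm) (hAk : A.mulVec k = 0)
    (K : Matrix (Fin 3) (Fin 3) ℝ) (hK : K.trace = 0)
    (F : MvPolynomial (Fin 3) ℝ) (hF : F.IsHomogeneous 3) (hKF : dotGradLin K F = 0)
    (ktil : Matrix (Fin 3) (Fin 3) ℝ) (hktil : ∀ w, ktil.mulVec w = crossProduct k w) :
    (∀ g h l, pbracket k A K F (pbracket k A K F g h) l
            + pbracket k A K F (pbracket k A K F h l) g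
            + pbracket k A K F (pbracket k A K F l g) h = 0) ↔
      dotGradConst k F = -(C (1 / 6 : ℝ)) * quadForm (((12 : ℝ) • A + ktil) * K) := by
  simp only [pbracket_eq_crossBracket]
  rw [crossBracket_jacobi_iff, dotCurl_dualField k A K hA hAk hK F hKF ktil hktil, neg_eq_zero,
    neg_mul, eq_neg_iff_add_eq_zero]

end
end
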